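/- (Clustering in $BV$) Let $x_0\in\mathbb{R}^N$, $r>0$, $c>0$, $\alpha\in(0,1)$, $\gamma''>0$, and let $u\in BV(Q_r(x_0))$ satisfy (a) $|\{x\in Q_r(x_0):u(x)>c\}|>\alpha r^N$ and (b'') $[u]_{BV(Q_r(x_0))}\le\gamma'' c r^{N-1}$. Then for all $\delta,\lambda\in(0,1)$ there exist $x_1\in Q_r(x_0)$ and $\eta\in(0,1)$ independent of $u$ such that $|\{x\in Q_{\eta r}(x_1):u(x)>\lambda c\}|>(1-\delta)(\eta r)^N$. -/

import Mathlib

open MeasureTheory ENNReal Set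

noncomputable section

/-- The open axis-parallel cube in `ℝ^N` centered at `x` with side `r`. -/
def cube (N : ℕ) (x : EuclideanSpace ℝ (Fin N)) (r : ℝ) : Set (EuclideanSpace ℝ (Fin N)) :=
  {y | ∀ i, |y i - x i| < r / 2}

/-- The divergence of a vector field `φ : ℝ^N → ℝ^N`. -/
def divg (N : ℕ) (φ : EuclideanSpace ℝ (Fin N) → EuclideanSpace ℝ (Fin N))
    (x : EuclideanSpace ℝ (Fin N)) : ℝ :=
  ∑ i, fderiv ℝ φ x (EuclideanSpace.single i 1) i

/-- The set of values `∫_Ω u div φ` over smooth vector fields `φ` compactly supported in `Ω`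
with `‖φ‖ ≤ 1`; its supremum is the total variation of `u` on `Ω`. -/
def bvSet (N : ℕ) (Ω : Set (EuclideanSpace ℝ (Fin N))) (u : EuclideanSpace ℝ (Fin N) → ℝ) :
    Set ℝ :=
  {y | ∃ φ : EuclideanSpace ℝ (Fin N) → EuclideanSpace ℝ (Fin N),
    ContDiff ℝ (⊤ : ℕ∞) φ ∧ HasCompactSupport φ ∧ tsupport φ ⊆ Ω ∧ (∀ x, ‖φ x‖ ≤ 1) ∧
    y = ∫ x in Ω, u x * divg N φ x}

open Filter Topology Metric in
theorem exists_smooth_tendsto_indicator {E : Type*} [NormedAddCommGroup E]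
    [InnerProductSpace ℝ E] [FiniteDimensional ℝ E] [MeasurableSpace E] [BorelSpace E]
    {μ : Measure E} [μ.IsAddHaarMeasure] {S : Set E} (hS : MeasurableSet S)
    (hb : Bornology.IsBounded S) {ε : ℝ} (hε : 0 < ε) :
    ∃ ψ : ℕ → E → ℝ, (∀ n, ContDiff ℝ (⊤ : ℕ∞) (ψ n)) ∧ (∀ n, HasCompactSupport (ψ n)) ∧
      (∀ n x, |ψ n x| ≤ 1) ∧ (∀ n, tsupport (ψ n) ⊆ cthickening ε S) ∧
      ∀ᵐ x ∂μ, Tendsto (fun n => ψ n x) atTop (𝓝 (S.indicator (fun _ => (1 : ℝ)) x)) := by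
  let ρ : ℕ → ContDiffBump (0 : E) := fun n =>
    { rIn := ε / (n + 1) / 2
      rOut := ε / (n + 1)
      rIn_pos := by positivity
      rIn_lt_rOut := by
        have : 0 < ε / ((n : ℝ) + 1) := by positivity
        linarith }
  have hρ : ∀ n, (ρ n).rOut ≤ ε := fun n =>
    div_le_self hε.le (by linarith [(Nat.cast_nonneg n : (0 : ℝ) ≤ n)])
  have hint : Integrable (S.indicator (fun _ => (1 : ℝ))) μ :=
    (integrable_indicator_iff hS).2 (integrableOn_const hb.measure_lt_top.ne)
  let ψ : ℕ → E → ℝ := fun n =>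
    convolution ((ρ n).normed μ) (S.indicator (fun _ => (1 : ℝ)))
      (ContinuousLinearMap.lsmul ℝ ℝ) μ
  have hts : ∀ n, tsupport (ψ n) ⊆ cthickening ε S := by
    intro n
    refine closure_minimal ?_ isClosed_cthickening
    refine (support_convolution_subset _).trans ?_
    rintro _ ⟨a, ha, b, hbS, rfl⟩
    rw [(ρ n).support_normed_eq, mem_ball_zero_iff] at ha
    have hbS' : b ∈ S := Set.mem_of_indicator_ne_zero hbS
    refine mem_cthickening_of_dist_le (a + b) b ε S hbS' ?_
    rw [dist_eq_norm, add_sub_cancel_right]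
    exact ha.le.trans (hρ n)
  refine ⟨ψ, fun n => ?_, fun n => ?_, fun n x => ?_, hts, ?_⟩
  · exact (ρ n).hasCompactSupport_normed.contDiff_convolution_left _ (ρ n).contDiff_normed
      hint.locallyIntegrable
  · exact isCompact_of_isClosed_isBounded (isClosed_tsupport _) (hb.cthickening.subset (hts n))
  · have h01 : ∀ y, |S.indicator (fun _ => (1 : ℝ)) y| ≤ 1 := by
      intro y
      by_cases hy : y ∈ S <;> simp [hy]
    calc |ψ n x| ≤ ∫ t, (ρ n).normed μ t ∂μ := by
          have hi : Integrable ((ρ n).normed μ) μ := (ρ n).integrable_normed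
          change ‖∫ t, ContinuousLinearMap.lsmul ℝ ℝ ((ρ n).normed μ t)
            (S.indicator (fun _ => (1 : ℝ)) (x - t)) ∂μ‖ ≤ _
          refine norm_integral_le_of_norm_le hi (ae_of_all _ fun t => ?_)
          simp only [ContinuousLinearMap.lsmul_apply, smul_eq_mul, norm_mul, Real.norm_eq_abs]
          rw [abs_of_nonneg ((ρ n).nonneg_normed t)]
          exact mul_le_of_le_one_right ((ρ n).nonneg_normed t) (h01 _)
      _ = 1 := (ρ n).integral_normed (μ := μ)
  · refine ContDiffBump.ae_convolution_tendsto_right_of_locallyIntegrable (K := 2) ?_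
      (Eventually.of_forall fun n => ?_) hint.locallyIntegrable
    · simpa [ρ, div_eq_mul_inv] using
        (tendsto_one_div_add_atTop_nhds_zero_nat (𝕜 := ℝ)).const_mul ε
    · change ε / (n + 1) ≤ 2 * (ε / (n + 1) / 2)
      linarith

theorem divg_smul_const {N : ℕ} {f : EuclideanSpace ℝ (Fin N) → ℝ}
    (x w : EuclideanSpace ℝ (Fin N)) (hf : DifferentiableAt ℝ f x) :
    divg N (fun y => f y • w) x = fderiv ℝ f x w := by
  unfold divg
  rw [fderiv_smul_const hf]
  conv_rhs => rw [← (EuclideanSpace.basisFun (Fin N) ℝ).sum_repr w]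
  simp [map_sum, mul_comm]

theorem norm_integral_mul_sub_translate_le {N : ℕ} {Ω : Set (EuclideanSpace ℝ (Fin N))}
    {v : EuclideanSpace ℝ (Fin N) → ℝ} {V : ℝ} (hv : Integrable v)
    (hV : ∀ φ : EuclideanSpace ℝ (Fin N) → EuclideanSpace ℝ (Fin N),
      ContDiff ℝ (⊤ : ℕ∞) φ → HasCompactSupport φ → tsupport φ ⊆ Ω → (∀ x, ‖φ x‖ ≤ 1) →
      ∫ x, v x * divg N φ x ≤ V)
    {ψ : EuclideanSpace ℝ (Fin N) → ℝ} (hψ : ContDiff ℝ (⊤ : ℕ∞) ψ)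
    (hc : HasCompactSupport ψ) (h1 : ∀ x, |ψ x| ≤ 1) (h : EuclideanSpace ℝ (Fin N))
    (hsub : ∀ t ∈ Icc (0 : ℝ) 1, ∀ x ∈ tsupport ψ, x + t • h ∈ Ω) :
    ‖(∫ y, v y * ψ (y - h)) - ∫ y, v y * ψ y‖ ≤ ‖h‖ * V := by
  rcases eq_or_ne h 0 with rfl | hh
  · simp
  have hh' : 0 < ‖h‖ := norm_pos_iff.2 hh
  have hdψ : Differentiable ℝ ψ := hψ.differentiable (by simp)
  have hcd : Continuous (fderiv ℝ ψ) := hψ.continuous_fderiv (by simp)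
  obtain ⟨C, hC⟩ := (hc.fderiv ℝ).exists_bound_of_continuous hcd
  have hsh : ∀ (t : ℝ), Continuous fun y : EuclideanSpace ℝ (Fin N) => y - t • h :=
    fun t => by fun_prop
  have hderiv : ∀ t : ℝ, HasDerivAt (fun t : ℝ => ∫ y, v y * ψ (y - t • h))
      (∫ y, v y * -(fderiv ℝ ψ (y - t • h) h)) t := by
    intro t
    refine (hasDerivAt_integral_of_dominated_loc_of_deriv_le (s := univ)
      (F := fun (t : ℝ) y => v y * ψ (y - t • h))
      (F' := fun (t : ℝ) y => v y * -(fderiv ℝ ψ (y - t • h) h))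
      (bound := fun y => ‖v y‖ * (C * ‖h‖)) Filter.univ_mem ?_ ?_ ?_ ?_ ?_ ?_).2
    · refine Filter.Eventually.of_forall fun s => hv.1.mul ?_
      exact (hψ.continuous.comp (hsh s)).aestronglyMeasurable
    · exact hv.mul_bdd (c := 1) (hψ.continuous.comp (hsh t)).aestronglyMeasurable
        (ae_of_all _ fun y => h1 _)
    · refine hv.1.mul ?_
      exact ((hcd.comp (hsh t)).clm_apply continuous_const).neg.aestronglyMeasurable
    · refine ae_of_all _ fun y s _ => ?_
      rw [norm_mul, norm_neg]
      exact mul_le_mul_of_nonneg_left (((fderiv ℝ ψ (y - s • h)).le_opNorm h).trans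
        (mul_le_mul_of_nonneg_right (hC _) (norm_nonneg _))) (norm_nonneg _)
    · exact hv.norm.mul_const _
    · refine ae_of_all _ fun y s _ => ?_
      have e : HasDerivAt (fun s : ℝ => y - s • h) (-h) s := by
        simpa using ((hasDerivAt_id s).smul_const h).const_sub y
      simpa using ((hdψ (y - s • h)).hasFDerivAt.comp_hasDerivAt s e).const_mul (v y)
  have key : ∀ t ∈ Icc (0 : ℝ) 1, ∀ σ : ℝ, |σ| = 1 →
      σ * ∫ y, v y * -(fderiv ℝ ψ (y - t • h) h) ≤ ‖h‖ * V := by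
    intro t ht σ hσ
    have hf : ContDiff ℝ (⊤ : ℕ∞) fun y => ψ (y - t • h) :=
      hψ.comp (contDiff_id.sub contDiff_const)
    have hts : tsupport (fun y => ψ (y - t • h) • (-(σ / ‖h‖) • h)) ⊆
        (fun x => x - t • h) ⁻¹' tsupport ψ := by
      refine closure_minimal (fun y hy => ?_) ((isClosed_tsupport ψ).preimage (hsh t))
      refine subset_tsupport ψ fun h0 => hy ?_
      simp [h0]
    have hcs : HasCompactSupport fun y => ψ (y - t • h) :=
      hc.comp_homeomorph (Homeomorph.subRight (t • h))
    have := hV (fun y => ψ (y - t • h) • (-(σ / ‖h‖) • h)) (hf.smul contDiff_const)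
      hcs.smul_right (fun y hy => by simpa using hsub t ht _ (hts hy)) (fun y => by
        rw [norm_smul, norm_smul, norm_neg, norm_div, Real.norm_eq_abs, Real.norm_eq_abs, hσ,
          norm_norm, one_div, inv_mul_cancel₀ hh'.ne', mul_one]
        exact h1 _)
    have hd : ∀ y, divg N (fun y => ψ (y - t • h) • (-(σ / ‖h‖) • h)) y =
        (σ / ‖h‖) * -(fderiv ℝ ψ (y - t • h) h) := by
      intro y
      rw [divg_smul_const _ _ (hf.differentiable (by simp) y), fderiv_comp_sub]
      simp
    simp_rw [hd, mul_left_comm (v _)] at this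
    rw [integral_const_mul, div_mul_eq_mul_div, div_le_iff₀ hh'] at this
    linarith
  have := norm_image_sub_le_of_norm_deriv_le_segment_01'
    (fun t _ => (hderiv t).hasDerivWithinAt) (C := ‖h‖ * V) (fun t ht => by
      have ht' : t ∈ Icc (0 : ℝ) 1 := ⟨ht.1, ht.2.le⟩
      refine abs_le'.2 ⟨?_, ?_⟩
      · simpa using key t ht' 1 (by simp)
      · simpa using key t ht' (-1) (by simp))
  simpa using this

open Filter Topology Metric in
theorem setIntegral_sub_translate_le {N : ℕ} {Ω : Set (EuclideanSpace ℝ (Fin N))}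
    {v : EuclideanSpace ℝ (Fin N) → ℝ} {V : ℝ} (hv : Integrable v)
    (hV : ∀ φ : EuclideanSpace ℝ (Fin N) → EuclideanSpace ℝ (Fin N),
      ContDiff ℝ (⊤ : ℕ∞) φ → HasCompactSupport φ → tsupport φ ⊆ Ω → (∀ x, ‖φ x‖ ≤ 1) →
      ∫ x, v x * divg N φ x ≤ V)
    {S : Set (EuclideanSpace ℝ (Fin N))} (hS : MeasurableSet S) (hb : Bornology.IsBounded S)
    {ε : ℝ} (hε : 0 < ε) (h : EuclideanSpace ℝ (Fin N))
    (hsub : ∀ t ∈ Icc (0 : ℝ) 1, ∀ x ∈ cthickening ε S, x + t • h ∈ Ω) :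
    ∫ x in S, (v x - v (x + h)) ≤ ‖h‖ * V := by
  obtain ⟨ψ, hψ, hc, h1, hts, hlim⟩ := exists_smooth_tendsto_indicator (μ := volume) hS hb hε
  have hvh : Integrable fun x => v (x + h) := hv.comp_add_right h
  have hle : ∀ n, ∫ x, (v x - v (x + h)) * ψ n x ≤ ‖h‖ * V := by
    intro n
    have hm := (hψ n).continuous.aestronglyMeasurable (μ := volume)
    have h2 : ∫ x, v (x + h) * ψ n x = ∫ y, v y * ψ n (y - h) := by
      simpa using integral_add_right_eq_self (μ := volume) (fun y => v y * ψ n (y - h)) h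
    have h3 := norm_integral_mul_sub_translate_le hv hV (hψ n) (hc n) (h1 n) h
      (fun t ht x hx => hsub t ht x (hts n hx))
    simp_rw [sub_mul]
    rw [integral_sub (hv.mul_bdd (c := 1) hm (ae_of_all _ fun y => h1 n _))
      (hvh.mul_bdd (c := 1) hm (ae_of_all _ fun y => h1 n _)), h2]
    rw [Real.norm_eq_abs, abs_sub_comm] at h3
    exact (le_abs_self _).trans h3
  have hT : Tendsto (fun n => ∫ x, (v x - v (x + h)) * ψ n x) atTop
      (𝓝 (∫ x, (v x - v (x + h)) * S.indicator (fun _ => (1 : ℝ)) x)) := by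
    refine tendsto_integral_of_dominated_convergence (fun x => ‖v x - v (x + h)‖)
      (fun n => (hv.sub hvh).1.mul (hψ n).continuous.aestronglyMeasurable) (hv.sub hvh).norm
      (fun n => ae_of_all _ fun x => ?_) ?_
    · rw [norm_mul]
      exact mul_le_of_le_one_right (norm_nonneg _) (h1 n x)
    · filter_upwards [hlim] with x hx using hx.const_mul _
  have := le_of_tendsto' hT hle
  rwa [show (fun x => (v x - v (x + h)) * S.indicator (fun _ => (1 : ℝ)) x) =
    S.indicator (fun x => v x - v (x + h)) by
      ext x; by_cases hx : x ∈ S <;> simp [hx], integral_indicator hS] at this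

theorem isOpen_cube (N : ℕ) (x : EuclideanSpace ℝ (Fin N)) (r : ℝ) : IsOpen (cube N x r) := by
  have : cube N x r = ⋂ i, {y | |y i - x i| < r / 2} := by ext; simp [cube]
  rw [this]
  exact isOpen_iInter_of_finite fun i => isOpen_lt (by fun_prop) continuous_const

theorem volume_cube (N : ℕ) (x : EuclideanSpace ℝ (Fin N)) {r : ℝ} (hr : 0 ≤ r) :
    volume (cube N x r) = ENNReal.ofReal (r ^ N) := by
  have h : cube N x r = WithLp.ofLp ⁻¹'
      (univ.pi fun i => Ioo (x i - r / 2) (x i + r / 2)) := by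
    ext y
    simp only [cube, mem_ofPred_eq, mem_preimage, mem_pi, mem_univ, true_imp_iff, mem_Ioo]
    refine forall_congr' fun i => ?_
    rw [abs_lt]
    constructor <;> rintro ⟨h1, h2⟩ <;> constructor <;> linarith
  rw [h, (PiLp.volume_preserving_ofLp (Fin N)).measure_preimage
    (MeasurableSet.univ_pi fun i => measurableSet_Ioo).nullMeasurableSet, Real.volume_pi_Ioo]
  simp [ENNReal.ofReal_pow hr]

theorem norm_le_of_mem_cube {N : ℕ} {h : EuclideanSpace ℝ (Fin N)} {s : ℝ}
    (hh : h ∈ cube N 0 s) : ‖h‖ ≤ N * (s / 2) := by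
  conv_lhs => rw [← (EuclideanSpace.basisFun (Fin N) ℝ).sum_repr h]
  refine (norm_sum_le _ _).trans ?_
  refine (Finset.sum_le_card_nsmul _ _ (s / 2) fun i _ => ?_).trans (by simp)
  have := (hh i).le
  simpa [norm_smul] using this

open Metric in
theorem volume_inter_le_of_norm_le {N : ℕ} {Ω : Set (EuclideanSpace ℝ (Fin N))}
    {v : EuclideanSpace ℝ (Fin N) → ℝ} {V : ℝ} (hv : Integrable v)
    (hV : ∀ φ : EuclideanSpace ℝ (Fin N) → EuclideanSpace ℝ (Fin N),
      ContDiff ℝ (⊤ : ℕ∞) φ → HasCompactSupport φ → tsupport φ ⊆ Ω → (∀ x, ‖φ x‖ ≤ 1) →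
      ∫ x, v x * divg N φ x ≤ V)
    {S : Set (EuclideanSpace ℝ (Fin N))} (hS : MeasurableSet S) (hb : Bornology.IsBounded S)
    {ε : ℝ} (hε : 0 < ε) (h : EuclideanSpace ℝ (Fin N))
    (hsub : ∀ t ∈ Icc (0 : ℝ) 1, ∀ x ∈ cthickening ε S, x + t • h ∈ Ω)
    {a : ℝ} (ha : 0 < a) (hgap : ∀ x ∈ S, a ≤ v x - v (x + h)) :
    volume S ≤ ENNReal.ofReal (‖h‖ * V / a) := by
  have hfin : volume S ≠ ∞ := hb.measure_lt_top.ne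
  have h1 := setIntegral_mono_on (integrableOn_const (C := a) hfin)
    (hv.sub (hv.comp_add_right h)).integrableOn hS hgap
  have h2 := setIntegral_sub_translate_le hv hV hS hb hε h hsub
  rw [setIntegral_const, smul_eq_mul] at h1
  have h3 : volume.real S ≤ ‖h‖ * V / a := by
    rw [le_div_iff₀ ha]
    exact h1.trans h2
  rw [← ENNReal.ofReal_toReal hfin]
  exact ENNReal.ofReal_le_ofReal h3

theorem lintegral_slice_le {E : Type*} [AddGroup E] [MeasurableSpace E] [MeasurableAdd₂ E]
    {μ : Measure E} [SFinite μ] {A B H : Set E} (hA : MeasurableSet A) (hB : MeasurableSet B)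
    (hH : MeasurableSet H) {a b : ℝ≥0∞} (ha : ∀ x ∈ A, a ≤ μ (H ∩ {h | x + h ∈ B}))
    (hb : ∀ h ∈ H, μ (A ∩ {x | x + h ∈ B}) ≤ b) : a * μ A ≤ b * μ H := by
  let T : Set (E × E) := {p | p.1 ∈ A ∧ p.2 ∈ H ∧ p.1 + p.2 ∈ B}
  have hT : MeasurableSet T :=
    (measurable_fst hA).inter ((measurable_snd hH).inter (measurable_add hB))
  calc a * μ A = ∫⁻ x, A.indicator (fun _ => a) x ∂μ := (lintegral_indicator_const hA a).symm
    _ ≤ ∫⁻ x, μ (Prod.mk x ⁻¹' T) ∂μ := by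
      refine lintegral_mono fun x => ?_
      by_cases hx : x ∈ A
      · rw [indicator_of_mem hx]
        exact (ha x hx).trans (measure_mono fun h hh => ⟨hx, hh⟩)
      · simp [hx]
    _ = ∫⁻ h, μ ((fun x => (x, h)) ⁻¹' T) ∂μ := by
      rw [← Measure.prod_apply hT, Measure.prod_apply_symm hT]
    _ ≤ ∫⁻ h, H.indicator (fun _ => b) h ∂μ := by
      refine lintegral_mono fun h => ?_
      by_cases hh : h ∈ H
      · rw [indicator_of_mem hh]
        refine le_trans (measure_mono ?_) (hb h hh)
        exact fun x hx => ⟨hx.1, hx.2.2⟩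
      · have : (fun x => (x, h)) ⁻¹' T = ∅ := eq_empty_of_forall_notMem fun x hx => hh hx.2.1
        simp [this]
    _ = b * μ H := lintegral_indicator_const hH b

theorem add_mem_cube {N : ℕ} {x₀ x h : EuclideanSpace ℝ (Fin N)} {r s : ℝ}
    (hx : x ∈ cube N x₀ r) (hh : h ∈ cube N 0 s) : x + h ∈ cube N x₀ (r + s) := by
  intro i
  have h1 := abs_lt.1 (hx i)
  have h2 := abs_lt.1 (hh i)
  simp only [PiLp.zero_apply, sub_zero] at h2
  rw [PiLp.add_apply, abs_lt]
  constructor <;> linarith [h1.1, h1.2, h2.1, h2.2]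

theorem mem_cube_of_norm_lt {N : ℕ} {x : EuclideanSpace ℝ (Fin N)} {s : ℝ}
    (hx : ‖x‖ < s / 2) : x ∈ cube N 0 s := fun i => by
  simpa using (PiLp.norm_apply_le x i).trans_lt hx

theorem smul_mem_cube {N : ℕ} {x : EuclideanSpace ℝ (Fin N)} {s t : ℝ}
    (hx : x ∈ cube N 0 s) (ht : t ∈ Icc (0 : ℝ) 1) : t • x ∈ cube N 0 s := fun i => by
  have h := hx i
  simp only [PiLp.zero_apply, sub_zero, PiLp.smul_apply, smul_eq_mul, abs_mul] at h ⊢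
  refine (mul_le_of_le_one_left (abs_nonneg _) ?_).trans_lt h
  rw [abs_of_nonneg ht.1]
  exact ht.2

theorem cube_mono {N : ℕ} (x : EuclideanSpace ℝ (Fin N)) {r s : ℝ} (h : r ≤ s) :
    cube N x r ⊆ cube N x s := fun _ hy i => (hy i).trans_le (by linarith)

theorem isBounded_cube (N : ℕ) (x : EuclideanSpace ℝ (Fin N)) (r : ℝ) :
    Bornology.IsBounded (cube N x r) := by
  refine (Metric.isBounded_closedBall (x := x) (r := N * (r / 2))).subset fun y hy => ?_
  rw [mem_closedBall_iff_norm]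
  exact norm_le_of_mem_cube fun i => by simpa using hy i

theorem preimage_add_cube {N : ℕ} (x : EuclideanSpace ℝ (Fin N)) (s : ℝ) :
    (fun h => x + h) ⁻¹' cube N x s = cube N 0 s := by
  ext h
  simp [cube]

open Metric in
theorem exists_cube_of_integrable {N : ℕ} (hN : 1 ≤ N) {α γ δ lam η : ℝ}
    (hα : α < 1) (hγ : 0 < γ) (hδ : δ ∈ Ioo (0 : ℝ) 1)
    (hlam : lam ∈ Ioo (0 : ℝ) 1) (hη : 0 < η) (hη1 : 4 * N * η ≤ α)
    (hη2 : N * η * γ < α * δ * (1 - lam))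
    (x₀ : EuclideanSpace ℝ (Fin N)) {r c : ℝ} (hr : 0 < r) (hc : 0 < c)
    {v : EuclideanSpace ℝ (Fin N) → ℝ} (hvm : Measurable v) (hv : Integrable v)
    (hV : ∀ φ : EuclideanSpace ℝ (Fin N) → EuclideanSpace ℝ (Fin N),
      ContDiff ℝ (⊤ : ℕ∞) φ → HasCompactSupport φ → tsupport φ ⊆ cube N x₀ r →
      (∀ x, ‖φ x‖ ≤ 1) → ∫ x, v x * divg N φ x ≤ γ * c * (r ^ N / r))
    (hvol : ENNReal.ofReal (α * r ^ N) < volume (cube N x₀ r ∩ {x | c < v x})) :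
    ∃ x₁ ∈ cube N x₀ r, cube N x₁ (η * r) ⊆ cube N x₀ r ∧
      ENNReal.ofReal ((1 - δ) * (η * r) ^ N) <
        volume (cube N x₁ (η * r) ∩ {x | lam * c < v x}) := by
  by_contra! hcon
  set s := η * r with hs
  have hs0 : 0 < s := mul_pos hη hr
  have hN' : (1 : ℝ) ≤ N := by exact_mod_cast hN
  have hη4 : 4 * η ≤ 1 := by nlinarith
  have hsr : 4 * s ≤ r := by nlinarith
  have hα0 : 0 < α := lt_of_lt_of_le (by positivity) hη1
  have hlam' : 0 < 1 - lam := by linarith [hlam.2]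
  set A := cube N x₀ (r - 2 * s) ∩ {x | c < v x} with hAdef
  set B := {x | v x ≤ lam * c} with hBdef
  have hA : MeasurableSet A :=
    (isOpen_cube N _ _).measurableSet.inter (measurableSet_lt measurable_const hvm)
  have hB : MeasurableSet B := measurableSet_le hvm measurable_const
  have hAQ : A ⊆ cube N x₀ r := inter_subset_left.trans (cube_mono _ (by linarith))
  have hvolA : ENNReal.ofReal (α / 2 * r ^ N) ≤ volume A := by
    have hdiff : volume (cube N x₀ r \ cube N x₀ (r - 2 * s)) ≤
        ENNReal.ofReal (α / 2 * r ^ N) := by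
      rw [measure_sdiff (cube_mono _ (by linarith))
        (isOpen_cube N _ _).measurableSet.nullMeasurableSet
        (isBounded_cube N _ _).measure_lt_top.ne, volume_cube N _ hr.le,
        volume_cube N _ (by linarith), ← ENNReal.ofReal_sub _ (pow_nonneg (by linarith) _)]
      refine ENNReal.ofReal_le_ofReal ?_
      have hbern := one_add_mul_le_pow (a := -(2 * η)) (by linarith) N
      have : r - 2 * s = (1 + -(2 * η)) * r := by rw [hs]; ring
      rw [this, mul_pow]
      have hrN : 0 < r ^ N := pow_pos hr N
      nlinarith
    have hle : volume (cube N x₀ r ∩ {x | c < v x}) ≤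
        volume A + ENNReal.ofReal (α / 2 * r ^ N) := by
      refine (measure_mono fun x hx => ?_).trans ((measure_union_le A _).trans
        (add_le_add_right hdiff _))
      by_cases hx' : x ∈ cube N x₀ (r - 2 * s)
      · exact Or.inl ⟨hx', hx.2⟩
      · exact Or.inr ⟨hx.1, hx'⟩
    have hsplit : α * r ^ N = α / 2 * r ^ N + α / 2 * r ^ N := by ring
    rw [hsplit, ENNReal.ofReal_add (by positivity) (by positivity)] at hvol
    exact (ENNReal.add_le_add_iff_right ENNReal.ofReal_ne_top).1 (hvol.le.trans hle)
  have hlow : ∀ x ∈ A, ENNReal.ofReal (δ * s ^ N) ≤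
      volume (cube N 0 s ∩ {h | x + h ∈ B}) := by
    intro x hx
    have hsub : cube N x s ⊆ cube N x₀ r := by
      intro y hy
      have hy' : y - x ∈ cube N 0 s := fun i => by simpa using hy i
      have := cube_mono x₀ (by linarith : r - 2 * s + s ≤ r) (add_mem_cube hx.1 hy')
      simpa using this
    have h1 := hcon x (hAQ hx) hsub
    have h2 : cube N 0 s ∩ {h | x + h ∈ B} = (fun h => x + h) ⁻¹' (cube N x s ∩ B) := by
      rw [preimage_inter, preimage_add_cube]
      rfl
    rw [h2, measure_preimage_add]
    have h3 : volume (cube N x s) ≤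
        volume (cube N x s ∩ {y | lam * c < v y}) + volume (cube N x s ∩ B) := by
      refine (measure_mono fun y hy => ?_).trans (measure_union_le _ _)
      rcases lt_or_ge (lam * c) (v y) with h | h
      · exact Or.inl ⟨hy, h⟩
      · exact Or.inr ⟨hy, h⟩
    rw [volume_cube N x hs0.le] at h3
    have hsplit : s ^ N = (1 - δ) * s ^ N + δ * s ^ N := by ring
    have hδ1 : 0 < 1 - δ := by linarith [hδ.2]
    have hδ0 := hδ.1
    rw [hsplit, ENNReal.ofReal_add (by positivity) (by positivity)] at h3
    exact (ENNReal.add_le_add_iff_left ENNReal.ofReal_ne_top).1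
      (h3.trans (add_le_add_left h1 _))
  have hup : ∀ h ∈ cube N 0 s, volume (A ∩ {x | x + h ∈ B}) ≤
      ENNReal.ofReal (N * η * γ / (2 * (1 - lam)) * r ^ N) := by
    intro h hh
    refine (volume_inter_le_of_norm_le hv hV (S := A ∩ {x | x + h ∈ B}) (ε := s / 4)
      (a := (1 - lam) * c) (hA.inter ((measurable_add_const h) hB))
      ((isBounded_cube N x₀ r).subset (inter_subset_left.trans hAQ)) (by positivity) h ?_
      (by positivity) ?_).trans (ENNReal.ofReal_le_ofReal ?_)
    · intro t ht y hy
      obtain ⟨x, hx, hxy⟩ := mem_thickening_iff.1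
        (cthickening_subset_thickening' (by positivity : 0 < s / 2)
          (by linarith : s / 4 < s / 2) _ hy)
      rw [dist_eq_norm] at hxy
      have h1 := add_mem_cube (add_mem_cube hx.1.1 (mem_cube_of_norm_lt hxy))
        (smul_mem_cube hh ht)
      rw [add_sub_cancel] at h1
      exact cube_mono x₀ (by linarith) h1
    · rintro x ⟨⟨-, hx1⟩, hx2⟩
      have hx1' : c < v x := hx1
      have hx2' : v (x + h) ≤ lam * c := hx2
      linarith
    · rw [div_le_iff₀ (by positivity)]
      calc ‖h‖ * (γ * c * (r ^ N / r)) ≤ N * (s / 2) * (γ * c * (r ^ N / r)) :=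
            mul_le_mul_of_nonneg_right (norm_le_of_mem_cube hh) (by positivity)
        _ = N * η * γ / (2 * (1 - lam)) * r ^ N * ((1 - lam) * c) := by
            rw [hs]
            field_simp
  have hfin := lintegral_slice_le hA hB (isOpen_cube N 0 s).measurableSet hlow hup
  rw [volume_cube N 0 hs0.le, ← ENNReal.ofReal_mul (by positivity)] at hfin
  have hδ0 := hδ.1
  have hfin2 := (mul_le_mul_right hvolA _).trans hfin
  rw [← ENNReal.ofReal_mul (by positivity), ENNReal.ofReal_le_ofReal_iff (by positivity)] at hfin2
  have hlt : N * η * γ / (2 * (1 - lam)) < δ * (α / 2) := by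
    rw [div_lt_iff₀ (by positivity)]
    linarith
  have hpos : 0 < r ^ N * s ^ N := by positivity
  nlinarith

/-- Clustering in `BV`: `η` does not depend on `u` (nor on `x₀, r, c`). -/
theorem stmt13 (N : ℕ) (hN : 2 ≤ N) (α γ'' δ lam : ℝ)
    (hα : α ∈ Ioo (0:ℝ) 1) (hγ : 0 < γ'')
    (hδ : δ ∈ Ioo (0:ℝ) 1) (hlam : lam ∈ Ioo (0:ℝ) 1) :
    ∃ η ∈ Ioo (0:ℝ) 1, ∀ (x₀ : EuclideanSpace ℝ (Fin N)) (r c : ℝ), 0 < r → 0 < c →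
      ∀ u : EuclideanSpace ℝ (Fin N) → ℝ,
        IntegrableOn u (cube N x₀ r) →
        BddAbove (bvSet N (cube N x₀ r) u) →
        ENNReal.ofReal (α * r ^ N) < volume (cube N x₀ r ∩ {x | c < u x}) →
        sSup (bvSet N (cube N x₀ r) u) ≤ γ'' * c * r ^ ((N : ℝ) - 1) →
        ∃ x₁ ∈ cube N x₀ r,
          ENNReal.ofReal ((1 - δ) * (η * r) ^ N) <
            volume (cube N x₁ (η * r) ∩ {x | lam * c < u x}) := by
  have hN' : (2 : ℝ) ≤ N := by exact_mod_cast hN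
  have hα0 := hα.1
  have hδ0 := hδ.1
  have hlam' : 0 < 1 - lam := by linarith [hlam.2]
  obtain ⟨κ, hκ⟩ : ∃ κ, κ = α * δ * (1 - lam) := ⟨_, rfl⟩
  have hκ0 : 0 < κ := by rw [hκ]; positivity
  have hκα : κ ≤ α := by
    rw [hκ, mul_assoc]
    exact mul_le_of_le_one_right hα0.le
      (mul_le_one₀ hδ.2.le hlam'.le (by linarith [hlam.1]))
  obtain ⟨η, hη⟩ : ∃ η, η = κ / (4 * N * (1 + γ'')) := ⟨_, rfl⟩
  have hη0 : 0 < η := by rw [hη]; positivity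
  have hηκ : 4 * N * η * (1 + γ'') = κ := by
    rw [hη]
    field_simp
  have hNη : 0 < N * η := by positivity
  have hη1 : 4 * N * η ≤ α := by nlinarith
  have hη2 : N * η * γ'' < α * δ * (1 - lam) := by
    rw [← hκ]
    nlinarith [mul_pos hNη hγ]
  refine ⟨η, ⟨hη0, by nlinarith [hα.2]⟩, fun x₀ r c hr hc u hu hbdd hvol hsup => ?_⟩
  have hQ := (isOpen_cube N x₀ r).measurableSet
  have hU : Integrable ((cube N x₀ r).indicator u) := (integrable_indicator_iff hQ).2 hu
  obtain ⟨v, hvm, hvU⟩ := hU.1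
  have hset : ∀ (a : ℝ) (K : Set (EuclideanSpace ℝ (Fin N))), K ⊆ cube N x₀ r →
      volume (K ∩ {x | a < u x}) = volume (K ∩ {x | a < v x}) := by
    intro a K hK
    refine measure_congr ?_
    filter_upwards [hvU] with x hx
    refine propext (and_congr_right fun hxK => ?_)
    rw [indicator_of_mem (hK hxK)] at hx
    change a < u x ↔ a < v x
    rw [hx]
  rw [hset c _ Subset.rfl] at hvol
  rw [Real.rpow_sub_one hr.ne', Real.rpow_natCast] at hsup
  obtain ⟨x₁, hx₁, hsub, h⟩ := exists_cube_of_integrable (by omega) hα.2 hγ hδ hlam hη0 hη1 hη2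
    x₀ hr hc hvm.measurable (hU.congr hvU)
    (fun φ h1 h2 h3 h4 => by
      refine le_trans (le_of_eq ?_)
        ((le_csSup hbdd ⟨φ, h1, h2, h3, h4, rfl⟩).trans hsup)
      rw [← integral_indicator hQ]
      refine integral_congr_ae ?_
      filter_upwards [hvU] with x hx
      rw [← hx, indicator_mul_left]) hvol
  exact ⟨x₁, hx₁, by rwa [hset _ _ hsub]⟩

end
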